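/- Let X, Y ≥ 1, let p be a probability vector on {1,…,X} (the agent's predicted belief), and let B be an X×Y row-stochastic observation matrix that is TP2 with Σ_j B(j,y)·p(j) > 0 for every y ∈ {1,…,Y}. Let c₁ ∈ ℝ^X be nondecreasing, let c₂ ∈ ℝ^X be nonincreasing, and let α ∈ (0,1] satisfy α ≥ 1 − η_y(X) for every y ∈ {1,…,Y}, where η_y(i) = B(i,y)·p(i)/Σ_j B(j,y)·p(j). Define the agent's action a*(y) = 2 if CVaR_α(c₂;η_y) ≤ CVaR_α(c₁;η_y) and a*(y) = 1 otherwise. Then a* is nondecreasing (hence ordinal) in the observation: for every y ∈ {1,…,Y−1}, a*(y) = 2 implies a*(y+1) = 2. -/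

import Mathlib

open Finset

/-- `hfun π c α z = z + (1/α) · ∑ i, π i · max (c i − z) 0`. -/
noncomputable def hfun {X : ℕ} (π c : Fin X → ℝ) (α z : ℝ) : ℝ :=
  z + (1 / α) * ∑ i, π i * max (c i - z) 0

/-- `CVaR_α(c; π) = inf_z hfun π c α z`. -/
noncomputable def CVaR {X : ℕ} (π c : Fin X → ℝ) (α : ℝ) : ℝ :=
  ⨅ z : ℝ, hfun π c α z

/-- Bayesian posterior of belief `p` after observation `y` through likelihood matrix `B`. -/
noncomputable def post {X Y : ℕ} (B : Fin X → Fin Y → ℝ) (p : Fin X → ℝ)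
    (y : Fin Y) (i : Fin X) : ℝ :=
  B i y * p i / ∑ j, B j y * p j

/-- The agent's CVaR-optimal trading decision after observation `y`:
action `2` (sell) if `CVaR_α(c₂; η_y) ≤ CVaR_α(c₁; η_y)`, else action `1` (buy). -/
noncomputable def astar {X Y : ℕ} (B : Fin X → Fin Y → ℝ) (p : Fin X → ℝ)
    (c₁ c₂ : Fin X → ℝ) (α : ℝ) (y : Fin Y) : ℕ :=
  if CVaR (post B p y) c₂ α ≤ CVaR (post B p y) c₁ α then 2 else 1

/-- If `b` dominates `a` in the likelihood ratio order, then the `b`-weighted mean of a monotone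
function is at least its `a`-weighted mean (in denominator-free form). -/
theorem sum_mul_sum_le_of_likelihoodRatio {ι : Type*} [Fintype ι] [LinearOrder ι]
    {a b f : ι → ℝ} (hab : ∀ i j, i ≤ j → b i * a j ≤ a i * b j) (hf : Monotone f) :
    (∑ i, a i * f i) * ∑ j, b j ≤ (∑ i, b i * f i) * ∑ j, a j := by
  have key : 0 ≤ ∑ i, ∑ j, (b i * a j - a i * b j) * (f i - f j) := by
    refine sum_nonneg fun i _ => sum_nonneg fun j _ => ?_
    rcases le_total i j with h | h
    · exact mul_nonneg_of_nonpos_of_nonpos (by linarith [hab i j h]) (by linarith [hf h])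
    · exact mul_nonneg (by linarith [hab j i h]) (by linarith [hf h])
  have expand : ∑ i, ∑ j, (b i * a j - a i * b j) * (f i - f j) =
      2 * ((∑ i, b i * f i) * ∑ j, a j - (∑ i, a i * f i) * ∑ j, b j) := by
    have h : ∀ i j, (b i * a j - a i * b j) * (f i - f j) =
        b i * f i * a j - a i * f i * b j + (a i * (b j * f j) - b i * (a j * f j)) :=
      fun i j => by ring
    simp only [h, sum_add_distrib, sum_sub_distrib, ← sum_mul_sum]
    ring
  linarith

theorem sum_post_mul_eq {X Y : ℕ} (B : Fin X → Fin Y → ℝ) (p f : Fin X → ℝ) (y : Fin Y) :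
    ∑ i, post B p y i * f i = (∑ i, B i y * p i * f i) / ∑ j, B j y * p j := by
  simp only [post, sum_div, div_mul_eq_mul_div]

/-- Under a TP2 likelihood, posterior means of monotone functions increase in the observation. -/
theorem sum_post_mul_le_of_monotone {X Y : ℕ} {B : Fin X → Fin Y → ℝ} {p f : Fin X → ℝ}
    {y y' : Fin Y} (hp0 : ∀ i, 0 ≤ p i)
    (hB : ∀ i i', i ≤ i' → B i y' * B i' y ≤ B i y * B i' y')
    (hy : 0 < ∑ j, B j y * p j) (hy' : 0 < ∑ j, B j y' * p j) (hf : Monotone f) :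
    ∑ i, post B p y i * f i ≤ ∑ i, post B p y' i * f i := by
  rw [sum_post_mul_eq, sum_post_mul_eq, div_le_div_iff₀ hy hy']
  refine sum_mul_sum_le_of_likelihoodRatio (fun i j hij => ?_) hf
  have := mul_le_mul_of_nonneg_right (hB i j hij) (mul_nonneg (hp0 i) (hp0 j))
  linarith

theorem bddBelow_range_hfun {X : ℕ} {π : Fin X → ℝ} (c : Fin X → ℝ) {α : ℝ}
    (hπ0 : ∀ i, 0 ≤ π i) (hπ1 : ∑ i, π i = 1) (hα : α ∈ Set.Ioc (0 : ℝ) 1) :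
    BddBelow (Set.range (hfun π c α)) := by
  refine ⟨∑ i, π i * c i, ?_⟩
  rintro _ ⟨z, rfl⟩
  have h1 : ∑ i, π i * c i - z ≤ ∑ i, π i * max (c i - z) 0 := by
    calc ∑ i, π i * c i - z = ∑ i, π i * (c i - z) := by
          simp only [mul_sub, sum_sub_distrib, ← sum_mul, hπ1, one_mul]
      _ ≤ _ := sum_le_sum fun i _ => mul_le_mul_of_nonneg_left (le_max_left _ _) (hπ0 i)
  have h2 : 0 ≤ ∑ i, π i * max (c i - z) 0 :=
    sum_nonneg fun i _ => mul_nonneg (hπ0 i) (le_max_right _ _)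
  have h3 : 1 ≤ 1 / α := one_le_one_div hα.1 hα.2
  have h4 := le_mul_of_one_le_left h2 h3
  unfold hfun
  linarith

theorem CVaR_le_CVaR {X : ℕ} {π π' c : Fin X → ℝ} {α : ℝ}
    (hπ0 : ∀ i, 0 ≤ π i) (hπ1 : ∑ i, π i = 1) (hα : α ∈ Set.Ioc (0 : ℝ) 1)
    (h : ∀ z, ∑ i, π i * max (c i - z) 0 ≤ ∑ i, π' i * max (c i - z) 0) :
    CVaR π c α ≤ CVaR π' c α := by
  refine ciInf_mono (bddBelow_range_hfun c hπ0 hπ1 hα) fun z => ?_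
  have := mul_le_mul_of_nonneg_left (h z) (one_div_pos.2 hα.1).le
  unfold hfun
  linarith

/-- The CVaR-optimal action of a risk-averse agent is nondecreasing (ordinal) in
its private observation. -/
theorem action_monotone_in_observation (X Y : ℕ) (hX : 1 ≤ X) (hY : 1 ≤ Y)
    (p : Fin X → ℝ) (hp0 : ∀ i, 0 ≤ p i) (hp1 : ∑ i, p i = 1)
    (B : Fin X → Fin Y → ℝ) (hB0 : ∀ i y, 0 ≤ B i y)
    (hBrow : ∀ i, ∑ y, B i y = 1)
    (hTP2 : ∀ (i i' : Fin X) (y y' : Fin Y),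
      i ≤ i' → y ≤ y' → B i y' * B i' y ≤ B i y * B i' y')
    (hden : ∀ y : Fin Y, 0 < ∑ j, B j y * p j)
    (c₁ c₂ : Fin X → ℝ) (hc₁ : Monotone c₁) (hc₂ : Antitone c₂)
    (α : ℝ) (hα : α ∈ Set.Ioc (0 : ℝ) 1)
    (hαbig : ∀ y : Fin Y, 1 - post B p y ⟨X - 1, by omega⟩ ≤ α) :
    ∀ (y : ℕ) (hy : y + 1 < Y),
      astar B p c₁ c₂ α ⟨y, Nat.lt_of_succ_lt hy⟩ = 2 →
        astar B p c₁ c₂ α ⟨y + 1, hy⟩ = 2 := by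
  intro y hy h
  have hpost0 : ∀ y i, 0 ≤ post B p y i := fun y i =>
    div_nonneg (mul_nonneg (hB0 i y) (hp0 i)) (hden y).le
  have hpost1 : ∀ y, ∑ i, post B p y i = 1 := fun y => by
    simp only [post, ← sum_div]
    exact div_self (hden y).ne'
  have hle : (⟨y, Nat.lt_of_succ_lt hy⟩ : Fin Y) ≤ ⟨y + 1, hy⟩ := Nat.le_succ y
  have mean_le := fun (f : Fin X → ℝ) (hf : Monotone f) =>
    sum_post_mul_le_of_monotone hp0 (fun i i' hi => hTP2 i i' _ _ hi hle)
      (hden _) (hden _) hf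
  have h₁ : CVaR (post B p ⟨y, Nat.lt_of_succ_lt hy⟩) c₁ α ≤
      CVaR (post B p ⟨y + 1, hy⟩) c₁ α :=
    CVaR_le_CVaR (hpost0 _) (hpost1 _) hα fun z =>
      mean_le _ fun i j hij => max_le_max_right 0 (sub_le_sub_right (hc₁ hij) z)
  have h₂ : CVaR (post B p ⟨y + 1, hy⟩) c₂ α ≤
      CVaR (post B p ⟨y, Nat.lt_of_succ_lt hy⟩) c₂ α := by
    refine CVaR_le_CVaR (hpost0 _) (hpost1 _) hα fun z => ?_
    have := mean_le (fun i => -max (c₂ i - z) 0) fun i j hij =>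
      neg_le_neg (max_le_max_right 0 (sub_le_sub_right (hc₂ hij) z))
    simpa only [mul_neg, sum_neg_distrib, neg_le_neg_iff] using this
  unfold astar at h ⊢
  split_ifs at h with h'
  · exact if_pos (h₂.trans (h'.trans h₁))
  · exact absurd h (by decide)
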